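/- arXiv:2604.06379 — 4 statements merged into one kernel-verified Lean document; each statement's English description precedes it below -/
import Mathlib

section
/- Let X and Y be real Banach spaces, let A ⊆ X be an open subset, let W ⊆ X be a finite-dimensional linear subspace, and let K ⊆ W ∩ A be a compact and convex subset. Let 𝒴 : X → Y be continuously Fréchet differentiable on A, assume that the restriction of 𝒴 to W ∩ A is injective, and assume that for every x ∈ W ∩ A the restriction of the Fréchet derivative 𝒴'(x) to W is injective. Then there exists a constant C > 0 such that ‖x₁ − x₂‖_X ≤ C ‖𝒴(x₁) − 𝒴(x₂)‖_Y for all x₁, x₂ ∈ K. -/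
open Filter Topology

/-- If the strict derivative of `f` at `p` is injective on a finite-dimensional subspace `W`, then
`f` has a Lipschitz inverse on `W` near `p`. -/
theorem HasStrictFDerivAt.exists_norm_sub_le_of_injOn_submodule
    {X Y : Type*} [NormedAddCommGroup X] [NormedSpace ℝ X]
    [NormedAddCommGroup Y] [NormedSpace ℝ Y] {W : Submodule ℝ X} [FiniteDimensional ℝ W]
    {f : X → Y} {f' : X →L[ℝ] Y} {p : X} (hf : HasStrictFDerivAt f f' p)
    (hinj : Set.InjOn f' W) :
    ∃ C : ℝ, 0 < C ∧ ∀ᶠ z : X × X in 𝓝 (p, p), z.1 ∈ W → z.2 ∈ W →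
      ‖z.1 - z.2‖ ≤ C * ‖f z.1 - f z.2‖ := by
  obtain ⟨κ, hκ, hanti⟩ := ((f' : X →ₗ[ℝ] Y).comp W.subtype).exists_antilipschitzWith
    (LinearMap.ker_eq_bot.2 fun a b h => Subtype.ext (hinj a.2 b.2 h))
  have hκ' : (0 : ℝ) < κ := hκ
  refine ⟨2 * κ, by positivity, ?_⟩
  filter_upwards [hf.isLittleO.def (c := (2 * (κ : ℝ))⁻¹) (by positivity)] with z hz h₁ h₂
  have hlow : ‖z.1 - z.2‖ ≤ κ * ‖f' (z.1 - z.2)‖ := by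
    simpa [dist_eq_norm] using hanti.le_mul_dist (⟨z.1, h₁⟩ : W) ⟨z.2, h₂⟩
  have htri : ‖f' (z.1 - z.2)‖ ≤ ‖f z.1 - f z.2‖ + ‖f z.1 - f z.2 - f' (z.1 - z.2)‖ :=
    norm_le_insert _ _
  have hmul : (κ : ℝ) * ((2 * (κ : ℝ))⁻¹ * ‖z.1 - z.2‖) = ‖z.1 - z.2‖ / 2 := by
    field_simp
  have := mul_le_mul_of_nonneg_left (htri.trans (add_le_add_right hz _)) hκ'.le
  linarith

/-- Where a continuous map separates two points, the distance between points near them is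
controlled by the distance between their images. -/
theorem exists_eventually_norm_sub_le_of_ne
    {X Y : Type*} [NormedAddCommGroup X] [NormedAddCommGroup Y]
    {f : X → Y} {p q : X} (hp : ContinuousAt f p) (hq : ContinuousAt f q) (hne : f p ≠ f q) :
    ∃ C : ℝ, 0 < C ∧ ∀ᶠ z : X × X in 𝓝 (p, q), ‖z.1 - z.2‖ ≤ C * ‖f z.1 - f z.2‖ := by
  have hpos : 0 < ‖f p - f q‖ := norm_pos_iff.2 (sub_ne_zero.2 hne)
  refine ⟨(‖p - q‖ + 1) / ‖f p - f q‖, by positivity, ?_⟩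
  have hcont : ContinuousAt (fun z : X × X => ‖f z.1 - f z.2‖) (p, q) :=
    ((hp.comp' continuousAt_fst).sub (hq.comp' continuousAt_snd)).norm
  have hlt : ‖p - q‖ < (‖p - q‖ + 1) / ‖f p - f q‖ * ‖f p - f q‖ := by
    rw [div_mul_cancel₀ _ hpos.ne']
    exact lt_add_one _
  have hdist : ContinuousAt (fun z : X × X => ‖z.1 - z.2‖) (p, q) := by fun_prop
  exact (hdist.eventually_lt (continuousAt_const.mul hcont) hlt).mono fun _ h => h.le


/-- Abstract Lipschitz stability for inverse problems (Bourgeois):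
if `𝒴 : X → Y` is `C¹` on an open set `A`, injective on `W ∩ A` for a
finite-dimensional subspace `W`, with derivative injective on `W` at each point
of `W ∩ A`, then `𝒴` satisfies a Lipschitz stability estimate on any compact
convex `K ⊆ W ∩ A`. -/
theorem abstract_lipschitz_stability
    {X Y : Type*} [NormedAddCommGroup X] [NormedSpace ℝ X] [CompleteSpace X]
    [NormedAddCommGroup Y] [NormedSpace ℝ Y] [CompleteSpace Y]
    (A : Set X) (hA : IsOpen A)
    (W : Submodule ℝ X) (hW : FiniteDimensional ℝ W)
    (K : Set X) (hK : K ⊆ (W : Set X) ∩ A) (hKc : IsCompact K) (hKconv : Convex ℝ K)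
    (𝒴 : X → Y) (𝒴' : X → X →L[ℝ] Y)
    (hderiv : ∀ x ∈ A, HasFDerivAt 𝒴 (𝒴' x) x)
    (hderiv_cont : ContinuousOn 𝒴' A)
    (hinj : Set.InjOn 𝒴 ((W : Set X) ∩ A))
    (hderiv_inj : ∀ x ∈ (W : Set X) ∩ A, ∀ w₁ ∈ W, ∀ w₂ ∈ W,
      𝒴' x w₁ = 𝒴' x w₂ → w₁ = w₂) :
    ∃ C : ℝ, 0 < C ∧ ∀ x₁ ∈ K, ∀ x₂ ∈ K, ‖x₁ - x₂‖ ≤ C * ‖𝒴 x₁ - 𝒴 x₂‖ := by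
  have hlocal : ∀ z ∈ K ×ˢ K, ∃ C : ℝ, 0 < C ∧ ∀ᶠ y : X × X in 𝓝 z, y.1 ∈ W → y.2 ∈ W →
      ‖y.1 - y.2‖ ≤ C * ‖𝒴 y.1 - 𝒴 y.2‖ := by
    rintro ⟨p, q⟩ ⟨hp, hq⟩
    have hpA := hK hp
    have hqA := hK hq
    rcases eq_or_ne p q with rfl | hne
    · have hstrict : HasStrictFDerivAt 𝒴 (𝒴' p) p :=
        hasStrictFDerivAt_of_hasFDerivAt_of_continuousAt
          (eventually_of_mem (hA.mem_nhds hpA.2) hderiv)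
          (hderiv_cont.continuousAt (hA.mem_nhds hpA.2))
      exact hstrict.exists_norm_sub_le_of_injOn_submodule
        fun a ha b hb h => hderiv_inj p hpA a ha b hb h
    · obtain ⟨C, hC, h⟩ := exists_eventually_norm_sub_le_of_ne (hderiv p hpA.2).continuousAt
        (hderiv q hqA.2).continuousAt (hinj.ne hpA hqA hne)
      exact ⟨C, hC, h.mono fun _ h _ _ => h⟩
  obtain ⟨C, hC, h⟩ := (hKc.prod hKc).induction_on
    (p := fun s => ∃ C : ℝ, 0 < C ∧ ∀ y ∈ s, y.1 ∈ W → y.2 ∈ W →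
      ‖y.1 - y.2‖ ≤ C * ‖𝒴 y.1 - 𝒴 y.2‖)
    ⟨1, one_pos, by simp⟩
    (fun s t hst ⟨C, hC, h⟩ => ⟨C, hC, fun y hy => h y (hst hy)⟩)
    (fun s t ⟨C, hC, h⟩ ⟨D, hD, h'⟩ => ⟨C + D, add_pos hC hD, fun y hy h₁ h₂ => by
      have := mul_nonneg hC.le (norm_nonneg (𝒴 y.1 - 𝒴 y.2))
      have := mul_nonneg hD.le (norm_nonneg (𝒴 y.1 - 𝒴 y.2))
      rw [add_mul]
      rcases hy with hy | hy
      · linarith [h y hy h₁ h₂]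
      · linarith [h' y hy h₁ h₂]⟩)
    (fun z hz => by
      obtain ⟨C, hC, h⟩ := hlocal z hz
      exact ⟨_, mem_nhdsWithin_of_mem_nhds h, C, hC, fun _ hy => hy⟩)
  exact ⟨C, hC, fun x₁ h₁ x₂ h₂ => h (x₁, x₂) ⟨h₁, h₂⟩ (hK h₁).1 (hK h₂).1⟩
end

section
/- Let p ∈ ℝ² satisfy 0 < ‖p‖ < 1. Then there exists an incident-observation pair (x̂₁, θ₁) with (θ₁ − x̂₁)/2 = p; moreover the pair (−θ₁, −x̂₁) also satisfies (−x̂₁ − (−θ₁))/2 = p, the two pairs (x̂₁, θ₁) and (−θ₁, −x̂₁) are distinct, and every incident-observation pair (x̂, θ) with (θ − x̂)/2 = p is equal to either (x̂₁, θ₁) or (−θ₁, −x̂₁). -/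
theorem EuclideanSpace.norm_eq_one_iff_fin_two (x : EuclideanSpace ℝ (Fin 2)) :
    ‖x‖ = 1 ↔ x 0 ^ 2 + x 1 ^ 2 = 1 := by
  rw [← sq_eq_sq₀ (norm_nonneg x) zero_le_one, EuclideanSpace.real_norm_sq_eq,
    Fin.sum_univ_two, one_pow]

/-- A vector of the plane orthogonal to `(a, b) ≠ 0` is a multiple of `(-b, a)`, and its length
determines the factor up to sign. -/
theorem eq_or_eq_neg_of_orthogonal {a b c d t : ℝ} (hr : 0 < a ^ 2 + b ^ 2)
    (h : c * a + d * b = 0) (hn : c ^ 2 + d ^ 2 = t ^ 2 * (a ^ 2 + b ^ 2)) :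
    (c = -(t * b) ∧ d = t * a) ∨ (c = t * b ∧ d = -(t * a)) := by
  obtain ⟨s, hs⟩ : ∃ s, s * (a ^ 2 + b ^ 2) = a * d - b * c :=
    ⟨(a * d - b * c) / (a ^ 2 + b ^ 2), div_mul_cancel₀ _ hr.ne'⟩
  have hc : c = -(s * b) := mul_right_cancel₀ hr.ne' (by linear_combination a * h + b * hs)
  have hd : d = s * a := mul_right_cancel₀ hr.ne' (by linear_combination b * h - a * hs)
  have hst : s ^ 2 = t ^ 2 := by
    refine mul_right_cancel₀ hr.ne' ?_
    rw [← hn, hc, hd]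
    ring
  rcases sq_eq_sq_iff_eq_or_eq_neg.mp hst with rfl | rfl
  · exact Or.inl ⟨hc, hd⟩
  · exact Or.inr ⟨by linarith, by linarith⟩

/-- For every `p` in the punctured unit disk of `ℝ²` there are exactly two
incident-observation pairs `(x̂, θ)` of unit vectors with `(θ - x̂)/2 = p`,
namely some pair `(x̂₁, θ₁)` and the reversed pair `(-θ₁, -x̂₁)`. -/
theorem two_incident_observation_pairs
    (p : EuclideanSpace ℝ (Fin 2)) (hp0 : 0 < ‖p‖) (hp1 : ‖p‖ < 1) :
    ∃ x₁ θ₁ : EuclideanSpace ℝ (Fin 2),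
      ‖x₁‖ = 1 ∧ ‖θ₁‖ = 1 ∧ (2 : ℝ)⁻¹ • (θ₁ - x₁) = p ∧
      (2 : ℝ)⁻¹ • ((-x₁) - (-θ₁)) = p ∧
      (x₁, θ₁) ≠ (-θ₁, -x₁) ∧
      ∀ x θ : EuclideanSpace ℝ (Fin 2), ‖x‖ = 1 → ‖θ‖ = 1 →
        (2 : ℝ)⁻¹ • (θ - x) = p → (x, θ) = (x₁, θ₁) ∨ (x, θ) = (-θ₁, -x₁) := by
  have hp : ‖p‖ ^ 2 = p 0 ^ 2 + p 1 ^ 2 := by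
    rw [EuclideanSpace.real_norm_sq_eq, Fin.sum_univ_two]
  have hr : 0 < p 0 ^ 2 + p 1 ^ 2 := hp ▸ pow_pos hp0 2
  have hr1 : p 0 ^ 2 + p 1 ^ 2 < 1 := hp ▸ pow_lt_one₀ hp0.le hp1 two_ne_zero
  obtain ⟨t, ht0, ht⟩ : ∃ t : ℝ, 0 < t ∧ t ^ 2 * (p 0 ^ 2 + p 1 ^ 2) = 1 - (p 0 ^ 2 + p 1 ^ 2) := by
    have hpos : 0 < (1 - (p 0 ^ 2 + p 1 ^ 2)) / (p 0 ^ 2 + p 1 ^ 2) :=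
      div_pos (sub_pos.mpr hr1) hr
    exact ⟨_, Real.sqrt_pos.mpr hpos, by rw [Real.sq_sqrt hpos.le, div_mul_cancel₀ _ hr.ne']⟩
  obtain ⟨q, hq0, hq1⟩ : ∃ q : EuclideanSpace ℝ (Fin 2), q 0 = -(t * p 1) ∧ q 1 = t * p 0 :=
    ⟨!₂[-(t * p 1), t * p 0], by simp, by simp⟩
  refine ⟨q - p, q + p, ?_, ?_, by module, by module, ?_, ?_⟩
  · rw [EuclideanSpace.norm_eq_one_iff_fin_two, PiLp.sub_apply, PiLp.sub_apply, hq0, hq1]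
    linear_combination ht
  · rw [EuclideanSpace.norm_eq_one_iff_fin_two, PiLp.add_apply, PiLp.add_apply, hq0, hq1]
    linear_combination ht
  · intro h
    have hq : q = 0 := by
      have h1 : q - p = -(q + p) := congrArg Prod.fst h
      linear_combination (norm := module) (2 : ℝ)⁻¹ • h1
    rw [hq, PiLp.zero_apply] at hq0 hq1
    have ha : p 0 = 0 := (mul_eq_zero.mp hq1.symm).resolve_left ht0.ne'
    have hb : p 1 = 0 := (mul_eq_zero.mp (neg_eq_zero.mp hq0.symm)).resolve_left ht0.ne'
    simp [ha, hb] at hr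
  · intro x θ hx hθ h
    obtain ⟨m, rfl⟩ : ∃ m, x = m - p := ⟨x + p, by module⟩
    obtain rfl : θ = m + p := by
      linear_combination (norm := module) (2 : ℝ) • h
    rw [EuclideanSpace.norm_eq_one_iff_fin_two, PiLp.sub_apply, PiLp.sub_apply] at hx
    rw [EuclideanSpace.norm_eq_one_iff_fin_two, PiLp.add_apply, PiLp.add_apply] at hθ
    have hm : m = q ∨ m = -q := by
      refine (eq_or_eq_neg_of_orthogonal (c := m 0) (d := m 1) (t := t) hr
        (by linarith) (by linarith)).imp ?_ ?_
      · rintro ⟨h0, h1⟩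
        ext i
        fin_cases i
        · exact h0.trans hq0.symm
        · exact h1.trans hq1.symm
      · rintro ⟨h0, h1⟩
        ext i
        fin_cases i
        · simp [h0, hq0]
        · simp [h1, hq1]
    rcases hm with rfl | rfl
    · exact Or.inl rfl
    · exact Or.inr (Prod.ext (by module) (by module))
end

section
/- Let f be a complex-valued function defined on pairs of unit vectors in ℝ² satisfying the reciprocity relation f(x̂, θ) = f(−θ, −x̂) for all unit vectors x̂, θ. Let (x̂₁, θ₁) and (x̂₂, θ₂) be incident-observation pairs with θ₁ − x̂₁ = θ₂ − x̂₂ and 0 < ‖θ₁ − x̂₁‖ < 2. Then f(x̂₁, θ₁) = f(x̂₂, θ₂); in other words, f is uniquely determined by the value p = (θ − x̂)/2 on the set of pairs with 0 < ‖p‖ < 1. -/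
/-- In the plane, two orthogonal vectors which are both orthogonal to a common nonzero vector
cannot both be nonzero. -/
theorem eq_zero_or_eq_zero_of_pairwise_orthogonal {d s t : EuclideanSpace ℝ (Fin 2)} (hd : d ≠ 0)
    (hsd : inner ℝ s d = 0) (htd : inner ℝ t d = 0) (hst : inner ℝ s t = 0) :
    s = 0 ∨ t = 0 := by
  by_contra! h
  have hortho : Pairwise fun i j => inner ℝ (![d, s, t] i) (![d, s, t] j) = 0 := by
    intro i j hij
    fin_cases i <;> fin_cases j <;> simp_all [real_inner_comm]
  have hli := linearIndependent_of_ne_zero_of_inner_eq_zero (𝕜 := ℝ)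
    (v := ![d, s, t]) (by intro i; fin_cases i <;> simp [hd, h.1, h.2]) hortho
  simpa using hli.fintype_card_le_finrank

/-- Two chords of the unit circle with the same nonzero direction vector either coincide or are
exchanged by the point reflection through the centre. -/
theorem eq_or_eq_neg_of_sub_eq_sub_of_norm_eq_one {x₁ θ₁ x₂ θ₂ : EuclideanSpace ℝ (Fin 2)}
    (hx₁ : ‖x₁‖ = 1) (hθ₁ : ‖θ₁‖ = 1) (hx₂ : ‖x₂‖ = 1) (hθ₂ : ‖θ₂‖ = 1)
    (hdiff : θ₁ - x₁ = θ₂ - x₂) (hne : θ₁ - x₁ ≠ 0) : x₂ = x₁ ∨ x₂ = -θ₁ := by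
  obtain rfl : θ₂ = x₂ + (θ₁ - x₁) := by rw [hdiff]; abel
  have h₁ : inner ℝ x₁ x₁ = 1 := by rw [real_inner_self_eq_norm_sq, hx₁, one_pow]
  have h₂ : inner ℝ θ₁ θ₁ = 1 := by rw [real_inner_self_eq_norm_sq, hθ₁, one_pow]
  have h₃ : inner ℝ x₂ x₂ = 1 := by rw [real_inner_self_eq_norm_sq, hx₂, one_pow]
  have h₄ : inner ℝ (x₂ + (θ₁ - x₁)) (x₂ + (θ₁ - x₁)) = 1 := by
    rw [real_inner_self_eq_norm_sq, hθ₂, one_pow]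
  have c₁ := real_inner_comm x₁ θ₁
  have c₂ := real_inner_comm x₁ x₂
  have c₃ := real_inner_comm θ₁ x₂
  simp only [inner_add_left, inner_add_right, inner_sub_left, inner_sub_right] at h₄
  have key := eq_zero_or_eq_zero_of_pairwise_orthogonal (s := x₂ - x₁) (t := x₂ + θ₁) hne
    (by simp only [inner_sub_left, inner_sub_right]; linarith)
    (by simp only [inner_add_left, inner_sub_right]; linarith)
    (by simp only [inner_sub_left, inner_add_right]; linarith)
  exact key.imp sub_eq_zero.mp eq_neg_of_add_eq_zero_left

/-- A function on pairs of unit vectors of `ℝ²` satisfying the reciprocity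
relation `f(x̂, θ) = f(-θ, -x̂)` takes the same value on any two
incident-observation pairs with the same difference `θ - x̂`, provided
`0 < ‖θ - x̂‖ < 2`; i.e. the processed datum `u(p)`, `p = (θ - x̂)/2`, is well
defined for `0 < ‖p‖ < 1`. -/
theorem reciprocity_processed_data_well_defined
    (f : EuclideanSpace ℝ (Fin 2) → EuclideanSpace ℝ (Fin 2) → ℂ)
    (hrec : ∀ x θ : EuclideanSpace ℝ (Fin 2), ‖x‖ = 1 → ‖θ‖ = 1 →
      f x θ = f (-θ) (-x))
    (x₁ θ₁ x₂ θ₂ : EuclideanSpace ℝ (Fin 2))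
    (hx₁ : ‖x₁‖ = 1) (hθ₁ : ‖θ₁‖ = 1) (hx₂ : ‖x₂‖ = 1) (hθ₂ : ‖θ₂‖ = 1)
    (hdiff : θ₁ - x₁ = θ₂ - x₂)
    (h0 : 0 < ‖θ₁ - x₁‖) (h2 : ‖θ₁ - x₁‖ < 2) :
    f x₁ θ₁ = f x₂ θ₂ := by
  rcases eq_or_eq_neg_of_sub_eq_sub_of_norm_eq_one hx₁ hθ₁ hx₂ hθ₂ hdiff
    (norm_pos_iff.mp h0) with rfl | rfl
  · rw [sub_left_inj.mp hdiff]
  · obtain rfl : θ₂ = -x₁ := by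
      rw [sub_neg_eq_add] at hdiff
      exact add_right_cancel (hdiff.symm.trans (by abel))
    exact hrec x₁ θ₁ hx₁ hθ₁
end

section
/- Let X be a real Hilbert space, L : X → X a bounded linear operator with Hilbert-space adjoint L*, and let C, C′ : X → X be bounded self-adjoint positive semidefinite linear operators with ‖C′‖ ≤ b for a real b ≥ 0. Let N be a positive integer and r ∈ X. Then the operators L C L* + (1/N)·I and L C′ L* + (1/N)·I are invertible, and the Tikhonov–Phillips solutions Δq = C L* (L C L* + (1/N)·I)⁻¹ r and Δq′ = C′ L* (L C′ L* + (1/N)·I)⁻¹ r satisfy ‖Δq − Δq′‖ ≤ ζ₀ N² ‖C − C′‖, where ζ₀ = ‖L‖ ‖r‖ (1 + b ‖L‖²). -/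
open scoped InnerProductSpace

theorem inner_conj_adjoint_add_smul_one_ge
    {X : Type*} [NormedAddCommGroup X] [InnerProductSpace ℝ X] [CompleteSpace X]
    (L C : X →L[ℝ] X) (hC : ∀ x : X, 0 ≤ ⟪C x, x⟫_ℝ) (c : ℝ) (x : X) :
    ‖x‖ ^ 2 * c ≤
      ⟪(L * C * ContinuousLinearMap.adjoint L + c • (1 : X →L[ℝ] X)) x, x⟫_ℝ := by
  have h := hC (ContinuousLinearMap.adjoint L x)
  rw [ContinuousLinearMap.adjoint_inner_right] at h
  simp only [add_apply, mul_apply_eq_comp,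
    smul_apply, one_apply_eq_self, inner_add_left,
    real_inner_smul_left, real_inner_self_eq_norm_sq]
  linarith

theorem isUnit_conj_adjoint_add_smul_one
    {X : Type*} [NormedAddCommGroup X] [InnerProductSpace ℝ X] [CompleteSpace X]
    (L C : X →L[ℝ] X) (hC : ∀ x : X, 0 ≤ ⟪C x, x⟫_ℝ) {c : ℝ} (hc : 0 < c) :
    IsUnit (L * C * ContinuousLinearMap.adjoint L + c • (1 : X →L[ℝ] X)) :=
  ContinuousLinearMap.isUnit_of_forall_le_norm_inner_map _ (c := ⟨c, hc.le⟩) hc fun x =>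
    (inner_conj_adjoint_add_smul_one_ge L C hC c x).trans (le_abs_self _)

theorem norm_le_inv_mul_norm_conj_adjoint_add_smul_one
    {X : Type*} [NormedAddCommGroup X] [InnerProductSpace ℝ X] [CompleteSpace X]
    (L C : X →L[ℝ] X) (hC : ∀ x : X, 0 ≤ ⟪C x, x⟫_ℝ) {c : ℝ} (hc : 0 < c) (x : X) :
    ‖x‖ ≤ c⁻¹ * ‖(L * C * ContinuousLinearMap.adjoint L + c • (1 : X →L[ℝ] X)) x‖ := by
  have h := (inner_conj_adjoint_add_smul_one_ge L C hC c x).trans (real_inner_le_norm _ _)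
  rw [← div_eq_inv_mul, le_div_iff₀ hc]
  rcases (norm_nonneg x).eq_or_lt with hx | hx
  · rw [← hx, zero_mul]
    positivity
  · exact le_of_mul_le_mul_right (by linarith) hx

theorem ContinuousLinearMap.apply_ringInverse_apply
    {X : Type*} [NormedAddCommGroup X] [NormedSpace ℝ X]
    {A : X →L[ℝ] X} (hA : IsUnit A) (r : X) : A (Ring.inverse A r) = r := by
  rw [← mul_apply_eq_comp, Ring.mul_inverse_cancel _ hA,
    one_apply_eq_self]

/-- Lipschitz dependence of the Tikhonov–Phillips regularized solution
`Δq = C L* (L C L* + (1/N) I)⁻¹ r` on the prior covariance operator: for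
self-adjoint positive semidefinite `C, C'` with `‖C'‖ ≤ b`, the operators
`L C L* + (1/N) I` and `L C' L* + (1/N) I` are invertible and
`‖Δq - Δq'‖ ≤ ζ₀ N² ‖C - C'‖` with `ζ₀ = ‖L‖ ‖r‖ (1 + b ‖L‖²)`. -/
theorem tikhonov_phillips_covariance_stability
    {X : Type*} [NormedAddCommGroup X] [InnerProductSpace ℝ X] [CompleteSpace X]
    (L : X →L[ℝ] X)
    (C C' : X →L[ℝ] X) (hC : IsSelfAdjoint C) (hC' : IsSelfAdjoint C')
    (hCpos : ∀ x : X, 0 ≤ ⟪C x, x⟫_ℝ) (hC'pos : ∀ x : X, 0 ≤ ⟪C' x, x⟫_ℝ)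
    (b : ℝ) (hb : 0 ≤ b) (hC'b : ‖C'‖ ≤ b)
    (N : ℕ) (hN : 0 < N) (r : X) :
    IsUnit (L * C * ContinuousLinearMap.adjoint L +
        ((N : ℝ))⁻¹ • (1 : X →L[ℝ] X)) ∧
    IsUnit (L * C' * ContinuousLinearMap.adjoint L +
        ((N : ℝ))⁻¹ • (1 : X →L[ℝ] X)) ∧
    ‖C (ContinuousLinearMap.adjoint L
          (Ring.inverse (L * C * ContinuousLinearMap.adjoint L +
            ((N : ℝ))⁻¹ • (1 : X →L[ℝ] X)) r)) -
        C' (ContinuousLinearMap.adjoint L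
          (Ring.inverse (L * C' * ContinuousLinearMap.adjoint L +
            ((N : ℝ))⁻¹ • (1 : X →L[ℝ] X)) r))‖ ≤
      (‖L‖ * ‖r‖ * (1 + b * ‖L‖ ^ 2)) * (N : ℝ) ^ 2 * ‖C - C'‖ := by
  have hN' : (0 : ℝ) < (N : ℝ)⁻¹ := by positivity
  have hN1 : (1 : ℝ) ≤ N := by exact_mod_cast hN
  have hU := isUnit_conj_adjoint_add_smul_one L C hCpos hN'
  have hU' := isUnit_conj_adjoint_add_smul_one L C' hC'pos hN'
  refine ⟨hU, hU', ?_⟩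
  have hu := ContinuousLinearMap.apply_ringInverse_apply hU r
  have hv := ContinuousLinearMap.apply_ringInverse_apply hU' r
  set u := Ring.inverse (L * C * ContinuousLinearMap.adjoint L +
    (N : ℝ)⁻¹ • (1 : X →L[ℝ] X)) r
  set v := Ring.inverse (L * C' * ContinuousLinearMap.adjoint L +
    (N : ℝ)⁻¹ • (1 : X →L[ℝ] X)) r
  have hu_norm : ‖u‖ ≤ N * ‖r‖ := by
    simpa only [hu, inv_inv] using
      norm_le_inv_mul_norm_conj_adjoint_add_smul_one L C hCpos hN' u
  have hL (x : X) : ‖ContinuousLinearMap.adjoint L x‖ ≤ ‖L‖ * ‖x‖ := by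
    simpa only [LinearIsometryEquiv.norm_map] using
      (ContinuousLinearMap.adjoint L).le_opNorm x
  have h_resolvent : (L * C' * ContinuousLinearMap.adjoint L +
      (N : ℝ)⁻¹ • (1 : X →L[ℝ] X)) (u - v) =
        -L ((C - C') (ContinuousLinearMap.adjoint L u)) := by
    rw [map_sub, hv, ← hu]
    simp only [add_apply, mul_apply_eq_comp,
      sub_apply, map_sub]
    abel
  have hw : ‖(C - C') (ContinuousLinearMap.adjoint L u)‖ ≤
      ‖C - C'‖ * (‖L‖ * (N * ‖r‖)) :=
    (C - C').le_opNorm_of_le ((hL u).trans (by gcongr))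
  have huv : ‖u - v‖ ≤ N * (‖L‖ * (‖C - C'‖ * (‖L‖ * (N * ‖r‖)))) := by
    have h := norm_le_inv_mul_norm_conj_adjoint_add_smul_one L C' hC'pos hN' (u - v)
    rw [h_resolvent, norm_neg, inv_inv] at h
    refine h.trans ?_
    gcongr
    exact L.le_opNorm_of_le hw
  have h_split : C (ContinuousLinearMap.adjoint L u) - C' (ContinuousLinearMap.adjoint L v) =
      (C - C') (ContinuousLinearMap.adjoint L u) +
        C' (ContinuousLinearMap.adjoint L (u - v)) := by
    simp only [sub_apply, map_sub]
    abel
  have hC'uv : ‖C' (ContinuousLinearMap.adjoint L (u - v))‖ ≤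
      b * (‖L‖ * (N * (‖L‖ * (‖C - C'‖ * (‖L‖ * (N * ‖r‖)))))) :=
    (C'.le_of_opNorm_le hC'b _).trans (by gcongr; exact (hL _).trans (by gcongr))
  rw [h_split]
  calc _ ≤ ‖C - C'‖ * (‖L‖ * (N * ‖r‖)) +
        b * (‖L‖ * (N * (‖L‖ * (‖C - C'‖ * (‖L‖ * (N * ‖r‖)))))) :=
      norm_add_le_of_le hw hC'uv
    _ ≤ ‖C - C'‖ * (‖L‖ * ((N : ℝ) ^ 2 * ‖r‖)) +
        b * (‖L‖ * (N * (‖L‖ * (‖C - C'‖ * (‖L‖ * (N * ‖r‖)))))) := by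
      gcongr
      exact le_self_pow₀ hN1 two_ne_zero
    _ = _ := by ring
end
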